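/- arXiv:1701.03967 — 3 statements merged into one kernel-verified Lean document; each statement's English description precedes it below -/
import Mathlib

section
/- Let G̃ be a bisymmetric (n−1)×(n−1) real matrix, let g_0, g_n ∈ ℝ and g ∈ ℝ^{n−1} with ǧ := P g, and let e ∈ ℝ^{n−1} satisfy G̃ e = 0 and be either even (P e = e) or odd (P e = −e). Then the mesh vector v with node values v_j = 0 for j = 0,…,K and element values v_{j−1/2} = (−P)^{j−1} e for j = 1,…,K satisfies both FEM eigen-equations (I) and (II). -/
open Matrix

/-- The reversal operator on ℝ^m. -/
def revVec (m : ℕ) (p : Fin m → ℝ) : Fin m → ℝ := fun i => p i.rev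

/-- The operator −P (negated reversal). -/
def negRev (m : ℕ) (p : Fin m → ℝ) : Fin m → ℝ := -(revVec m p)

/-- A matrix is bisymmetric if it is symmetric w.r.t. the main and
secondary diagonals. -/
def Bisym {m : ℕ} (B : Matrix (Fin m) (Fin m) ℝ) : Prop :=
  (∀ i j, B i j = B j i) ∧ (∀ i j, B i j = B j.rev i.rev)

theorem revVec_dotProduct_add_dotProduct_negRev {m : ℕ} (p q : Fin m → ℝ) :
    revVec m p ⬝ᵥ q + p ⬝ᵥ negRev m q = 0 := by
  have h : revVec m p ⬝ᵥ q = p ⬝ᵥ revVec m q :=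
    Fintype.sum_equiv Fin.revPerm _ _ fun i => by simp [revVec]
  rw [h, negRev, dotProduct_neg, add_neg_cancel]

theorem negRev_neg {m : ℕ} (p : Fin m → ℝ) : negRev m (-p) = -negRev m p := rfl

/-- The orbit of an even or odd vector under `negRev` consists of the vector and its negative. -/
theorem negRev_iterate_eq_or_eq_neg {m : ℕ} {e : Fin m → ℝ}
    (heo : revVec m e = e ∨ revVec m e = -e) (k : ℕ) :
    (negRev m)^[k] e = e ∨ (negRev m)^[k] e = -e := by
  have h : negRev m e = e ∨ negRev m e = -e := by
    rcases heo with h | h <;> simp [negRev, h]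
  induction k with
  | zero => exact Or.inl rfl
  | succ k ih =>
    rw [Function.iterate_succ_apply']
    rcases ih with hk | hk <;> rcases h with h | h <;> simp [hk, h, negRev_neg]

/-- if G̃ e = 0 with e even or odd, then the mesh vector with
zero node values and element values (−P)^{j−1} e satisfies both FEM
eigen-equations (I) and (II). -/
theorem interior_eigenvector_satisfies_FEM_equations
    (n K : ℕ) (hn : 2 ≤ n) (hK : 2 ≤ K)
    (Gt : Matrix (Fin (n-1)) (Fin (n-1)) ℝ) (hGt : Bisym Gt)
    (g0 gn : ℝ) (g : Fin (n-1) → ℝ)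
    (e : Fin (n-1) → ℝ) (he : Gt.mulVec e = 0)
    (heo : revVec (n-1) e = e ∨ revVec (n-1) e = -e)
    (vN : ℕ → ℝ) (vE : ℕ → Fin (n-1) → ℝ)
    (hvN : ∀ j, j ≤ K → vN j = 0)
    (hvE : ∀ j, 1 ≤ j → j ≤ K → vE j = (negRev (n-1))^[j-1] e) :
    (∀ j, 1 ≤ j → j ≤ K - 1 →
      gn * vN (j-1) + revVec (n-1) g ⬝ᵥ vE j + 2 * g0 * vN j
        + g ⬝ᵥ vE (j+1) + gn * vN (j+1) = 0) ∧
    (∀ j, 1 ≤ j → j ≤ K →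
      vN (j-1) • g + Gt.mulVec (vE j) + vN j • revVec (n-1) g = 0) := by
  constructor
  · intro j h1 hj
    rw [hvN (j - 1) (by omega), hvN j (by omega), hvN (j + 1) (by omega),
      hvE j h1 (by omega), hvE (j + 1) (by omega) (by omega)]
    obtain ⟨k, rfl⟩ := Nat.exists_eq_add_of_le' h1
    have h := revVec_dotProduct_add_dotProduct_negRev g ((negRev (n-1))^[k] e)
    simpa [Function.iterate_succ_apply', -Function.iterate_succ] using h
  · intro j h1 hj
    rw [hvN (j - 1) (by omega), hvN j hj, hvE j h1 hj]
    rcases negRev_iterate_eq_or_eq_neg heo (j - 1) with h | h <;>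
      simp [h, he, Matrix.mulVec_neg]
end

section
/- Let G̃ be a bisymmetric invertible (n−1)×(n−1) real matrix, let g_0, g_n ∈ ℝ and g ∈ ℝ^{n−1} with ǧ := P g, and set p := −G̃^{−1} g, ĝ_0 := g_0 − g·G̃^{−1} g, ĝ_n := g_n − ǧ·G̃^{−1} g. Let k ∈ {1,…,K−1}, θ_k := cos(πk/K), and assume ĝ_0 + θ_k ĝ_n = 0. Then the mesh vector v with node values v_j = sin(πkj/K) for j = 0,…,K and element values v_{j−1/2} = p sin(πk(j−1)/K) + p̌ sin(πkj/K) for j = 1,…,K satisfies both FEM eigen-equations (I) and (II), and v is nonzero. -/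
open Matrix

theorem revVec_dotProduct {m : ℕ} (a b : Fin m → ℝ) :
    revVec m a ⬝ᵥ b = a ⬝ᵥ revVec m b :=
  Fintype.sum_equiv Fin.revPerm _ _ fun i => by simp [revVec]

theorem revVec_revVec {m : ℕ} (a : Fin m → ℝ) : revVec m (revVec m a) = a := by
  ext i
  simp [revVec]

theorem Bisym.mulVec_revVec {m : ℕ} {B : Matrix (Fin m) (Fin m) ℝ} (hB : Bisym B)
    (a : Fin m → ℝ) : B *ᵥ revVec m a = revVec m (B *ᵥ a) := by
  ext i
  refine Fintype.sum_equiv Fin.revPerm _ _ fun j => ?_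
  simp [revVec, hB.2 i j, hB.1 j.rev i.rev]

/-- if ĝ₀ + θ_k ĝ_n = 0 with θ_k = cos(πk/K), then the mesh
vector with node values sin(πkj/K) and element values
p sin(πk(j−1)/K) + p̌ sin(πkj/K), p = −G̃⁻¹ g, satisfies both FEM
eigen-equations (I) and (II), and is nonzero. -/
theorem sine_eigenvector_satisfies_FEM_equations
    (n K : ℕ) (hn : 2 ≤ n) (hK : 2 ≤ K)
    (Gt : Matrix (Fin (n-1)) (Fin (n-1)) ℝ) (hGt : Bisym Gt)
    (hGdet : IsUnit Gt.det)
    (g0 gn : ℝ) (g : Fin (n-1) → ℝ)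
    (k : ℕ) (hk1 : 1 ≤ k) (hk2 : k ≤ K - 1)
    (p : Fin (n-1) → ℝ) (hp : p = -(Gt⁻¹.mulVec g))
    (gh0 ghn : ℝ)
    (hgh0 : gh0 = g0 - g ⬝ᵥ Gt⁻¹.mulVec g)
    (hghn : ghn = gn - revVec (n-1) g ⬝ᵥ Gt⁻¹.mulVec g)
    (hroot : gh0 + Real.cos (Real.pi * k / K) * ghn = 0)
    (vN : ℕ → ℝ) (vE : ℕ → Fin (n-1) → ℝ)
    (hvN : ∀ j, j ≤ K → vN j = Real.sin (Real.pi * k * j / K))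
    (hvE : ∀ j, 1 ≤ j → j ≤ K →
      vE j = Real.sin (Real.pi * k * ((j : ℝ) - 1) / K) • p
           + Real.sin (Real.pi * k * j / K) • revVec (n-1) p) :
    (∀ j, 1 ≤ j → j ≤ K - 1 →
      gn * vN (j-1) + revVec (n-1) g ⬝ᵥ vE j + 2 * g0 * vN j
        + g ⬝ᵥ vE (j+1) + gn * vN (j+1) = 0) ∧
    (∀ j, 1 ≤ j → j ≤ K →
      vN (j-1) • g + Gt.mulVec (vE j) + vN j • revVec (n-1) g = 0) ∧
    ((∃ j, j ≤ K ∧ vN j ≠ 0) ∨ (∃ j, 1 ≤ j ∧ j ≤ K ∧ vE j ≠ 0)) := by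
  have hKpos : (0 : ℝ) < K := by exact_mod_cast (by omega : 0 < K)
  have hGp : Gt *ᵥ p = -g := by
    rw [hp, mulVec_neg, mulVec_mulVec, mul_nonsing_inv _ hGdet, one_mulVec]
  have hGp_rev : Gt *ᵥ revVec (n-1) p = -revVec (n-1) g := by
    rw [hGt.mulVec_revVec, hGp]
    rfl
  have hGinv : Gt⁻¹ *ᵥ g = -p := by rw [hp, neg_neg]
  rw [hGinv, dotProduct_neg, sub_neg_eq_add] at hgh0 hghn
  have hvN_pred : ∀ j, 1 ≤ j → j ≤ K →
      vN (j-1) = Real.sin (Real.pi * k * ((j : ℝ) - 1) / K) := by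
    intro j h1 h2
    rw [hvN _ (by omega), Nat.cast_sub h1, Nat.cast_one]
  refine ⟨fun j h1 h2 => ?_, fun j h1 h2 => ?_, Or.inl ⟨1, by omega, ?_⟩⟩
  · have hsin : Real.sin (Real.pi * k * ((j : ℝ) - 1) / K)
        + Real.sin (Real.pi * k * ((j : ℝ) + 1) / K)
        = 2 * Real.cos (Real.pi * k / K) * Real.sin (Real.pi * k * j / K) := by
      rw [show Real.pi * k * ((j : ℝ) - 1) / K
          = Real.pi * k * j / K - Real.pi * k / K by ring,
        show Real.pi * k * ((j : ℝ) + 1) / K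
          = Real.pi * k * j / K + Real.pi * k / K by ring,
        Real.sin_sub, Real.sin_add]
      ring
    rw [hvN_pred j h1 (by omega), hvE j h1 (by omega), hvE (j+1) (by omega) (by omega),
      hvN j (by omega), hvN (j+1) (by omega)]
    push_cast
    simp only [dotProduct_add, dotProduct_smul, smul_eq_mul, add_sub_cancel_right,
      ← revVec_dotProduct g p]
    rw [revVec_dotProduct g (revVec (n-1) p), revVec_revVec]
    linear_combination ghn * hsin + 2 * Real.sin (Real.pi * k * j / K) * hroot
      - 2 * Real.sin (Real.pi * k * j / K) * hgh0
      - (Real.sin (Real.pi * k * ((j : ℝ) - 1) / K)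
        + Real.sin (Real.pi * k * ((j : ℝ) + 1) / K)) * hghn
  · rw [hvN_pred j h1 h2, hvN j h2, hvE j h1 h2, mulVec_add, mulVec_smul, mulVec_smul,
      hGp, hGp_rev]
    module
  · have hkpos : (0 : ℝ) < k := by exact_mod_cast hk1
    have hkK : (k : ℝ) < K := by exact_mod_cast (by omega : k < K)
    rw [hvN 1 (by omega), Nat.cast_one, mul_one]
    refine (Real.sin_pos_of_pos_of_lt_pi (by positivity) ?_).ne'
    rw [div_lt_iff₀ hKpos]
    exact mul_lt_mul_of_pos_left hkK Real.pi_pos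
end

section
/- Let C̃ be a bisymmetric (n−1)×(n−1) real matrix, c_0, c_n ∈ ℝ, c ∈ ℝ^{n−1}, č := P c, e ∈ ℝ^{n−1}, and let s_0[e] be the mesh vector with node values 0 and element values (−P)^{j−1} e, j = 1,…,K. Then for every mesh vector y the plain inner product satisfies (y, s_0[e]) = (Σ_{j=1}^{K} (−P)^{j−1} y_{j−1/2}) · e, and (C s_0[e], s_0[e]) = K (C̃ e · e); in particular, if C̃ e · e = 1 then the squared C-norm of s_0[e] equals K. -/
open Matrix

/-- The plain inner product (y, v) of mesh vectors. -/
def plainIP (n K : ℕ) (yN : ℕ → ℝ) (yE : ℕ → Fin (n-1) → ℝ)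
    (vN : ℕ → ℝ) (vE : ℕ → Fin (n-1) → ℝ) : ℝ :=
  (∑ j ∈ Finset.Icc 1 (K-1), yN j * vN j)
  + ∑ j ∈ Finset.Icc 1 K, yE j ⬝ᵥ vE j

/-- The C-bilinear form (Cv, w) of mesh vectors. -/
def Cform (n K : ℕ) (Ct : Matrix (Fin (n-1)) (Fin (n-1)) ℝ) (c0 cn : ℝ)
    (c : Fin (n-1) → ℝ) (vN : ℕ → ℝ) (vE : ℕ → Fin (n-1) → ℝ)
    (wN : ℕ → ℝ) (wE : ℕ → Fin (n-1) → ℝ) : ℝ :=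
  (∑ j ∈ Finset.Icc 1 (K-1),
      (2 * c0 * vN j + cn * (vN (j-1) + vN (j+1))
        + revVec (n-1) c ⬝ᵥ vE j + c ⬝ᵥ vE (j+1)) * wN j)
  + ∑ j ∈ Finset.Icc 1 K,
      (vN (j-1) • c + Ct.mulVec (vE j) + vN j • revVec (n-1) c) ⬝ᵥ wE j

lemma negRev_involutive (m : ℕ) : Function.Involutive (negRev m) := by
  intro p
  ext i
  simp [negRev, revVec]

lemma negRev_dotProduct (m : ℕ) (p q : Fin m → ℝ) :
    negRev m p ⬝ᵥ q = p ⬝ᵥ negRev m q := by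
  simp only [dotProduct, negRev, revVec, Pi.neg_apply]
  rw [← Equiv.sum_comp Fin.revPerm]
  simp

lemma iterate_negRev_dotProduct (m k : ℕ) (p q : Fin m → ℝ) :
    (negRev m)^[k] p ⬝ᵥ q = p ⬝ᵥ (negRev m)^[k] q := by
  induction k generalizing p with
  | zero => rfl
  | succ k ih =>
    rw [Function.iterate_succ_apply, ih, negRev_dotProduct, Function.iterate_succ_apply']

lemma Bisym.mulVec_negRev {m : ℕ} {B : Matrix (Fin m) (Fin m) ℝ} (hB : Bisym B)
    (p : Fin m → ℝ) : B.mulVec (negRev m p) = negRev m (B.mulVec p) := by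
  ext i
  simp only [mulVec, dotProduct, negRev, revVec, Pi.neg_apply, mul_neg, Finset.sum_neg_distrib]
  rw [← Equiv.sum_comp Fin.revPerm]
  refine congrArg Neg.neg (Finset.sum_congr rfl fun j _ => ?_)
  rw [Fin.revPerm_apply, Fin.rev_rev, hB.2 i j.rev, Fin.rev_rev, hB.1]

lemma Bisym.mulVec_iterate_negRev_dotProduct {m : ℕ} {B : Matrix (Fin m) (Fin m) ℝ}
    (hB : Bisym B) (k : ℕ) (p : Fin m → ℝ) :
    B.mulVec ((negRev m)^[k] p) ⬝ᵥ (negRev m)^[k] p = B.mulVec p ⬝ᵥ p := by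
  have hcomm : Function.Semiconj B.mulVec (negRev m) (negRev m) := hB.mulVec_negRev
  rw [(hcomm.iterate_right k).eq, iterate_negRev_dotProduct,
    ← Function.iterate_add_apply, ← two_mul,
    (negRev_involutive m).iterate_two_mul, id]

/-- the plain inner product (y, s₀[e]) and the squared C-norm
of s₀[e]. -/
theorem s0_inner_product_and_norm
    (n K : ℕ) (hn : 2 ≤ n) (hK : 2 ≤ K)
    (Ct : Matrix (Fin (n-1)) (Fin (n-1)) ℝ) (hCt : Bisym Ct)
    (c0 cn : ℝ) (c : Fin (n-1) → ℝ)
    (e : Fin (n-1) → ℝ) :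
    (∀ (yN : ℕ → ℝ) (yE : ℕ → Fin (n-1) → ℝ), yN 0 = 0 → yN K = 0 →
      plainIP n K yN yE (fun _ => 0) (fun j => (negRev (n-1))^[j-1] e)
        = (∑ j ∈ Finset.Icc 1 K, (negRev (n-1))^[j-1] (yE j)) ⬝ᵥ e) ∧
    Cform n K Ct c0 cn c
        (fun _ => 0) (fun j => (negRev (n-1))^[j-1] e)
        (fun _ => 0) (fun j => (negRev (n-1))^[j-1] e)
      = K * (Ct.mulVec e ⬝ᵥ e) ∧
    (Ct.mulVec e ⬝ᵥ e = 1 →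
      Cform n K Ct c0 cn c
          (fun _ => 0) (fun j => (negRev (n-1))^[j-1] e)
          (fun _ => 0) (fun j => (negRev (n-1))^[j-1] e)
        = K) := by
  have hnorm : Cform n K Ct c0 cn c
        (fun _ => 0) (fun j => (negRev (n-1))^[j-1] e)
        (fun _ => 0) (fun j => (negRev (n-1))^[j-1] e)
      = K * (Ct.mulVec e ⬝ᵥ e) := by
    simp [Cform, hCt.mulVec_iterate_negRev_dotProduct]
  refine ⟨fun yN yE _ _ => ?_, hnorm, fun h => by rw [hnorm, h, mul_one]⟩
  simp [plainIP, sum_dotProduct, iterate_negRev_dotProduct]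
end
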